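/- arXiv:2603.01368 — 3 statements merged into one kernel-verified Lean document; each statement's English description precedes it below -/
import Mathlib

section
/- For every integer n ≥ 1 and every integer s with 0 ≤ s ≤ n, the inversion walk on labelled tournaments on [n] satisfies d_n(n − s) ≥ 1 − 2^n · n^s · 2^{−C(s,2)}. -/
open scoped BigOperators

/-- Index type for the coordinates of `F_2^{C(n,2)}`: unordered pairs `{i,j} ⊆ [n]`,
represented as ordered pairs `(i,j)` with `i < j`. -/
def PairIdx (n : ℕ) := {p : Fin n × Fin n // p.1 < p.2}

instance (n : ℕ) : Fintype (PairIdx n) := by unfold PairIdx; infer_instance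
instance (n : ℕ) : DecidableEq (PairIdx n) := by unfold PairIdx; infer_instance

/-- The clique vector `v_X ∈ F_2^{C(n,2)}`: coordinate at `{i,j}` is `1` iff `{i,j} ⊆ X`. -/
def cliqueVec (n : ℕ) (X : Finset (Fin n)) : PairIdx n → ZMod 2 :=
  fun p => if p.1.1 ∈ X ∧ p.1.2 ∈ X then 1 else 0

/-- `μ_t(z)`: the distribution at time `t` of the inversion walk started at `0`, i.e. the
probability that `v_{X_1} + ⋯ + v_{X_t} = z` for i.i.d. uniform subsets `X_1,…,X_t ⊆ [n]`.
This equals the `t`-fold convolution power of the step distribution. -/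
noncomputable def invMu (n t : ℕ) (z : PairIdx n → ZMod 2) : ℝ :=
  ((Finset.univ.filter (fun Xs : Fin t → Finset (Fin n) =>
      ∑ i, cliqueVec n (Xs i) = z)).card : ℝ) / 2 ^ (n * t)

/-- `d_n(t)`: total-variation distance of `μ_t` from the uniform distribution on
`F_2^{C(n,2)}`. -/
noncomputable def invDist (n t : ℕ) : ℝ :=
  (1 / 2) * ∑ z : PairIdx n → ZMod 2, |invMu n t z - ((2 : ℝ) ^ n.choose 2)⁻¹|


theorem card_filter_lt_offDiag {α : Type*} [LinearOrder α] (T : Finset α) :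
    (T.offDiag.filter fun p => p.1 < p.2).card = T.card.choose 2 := by
  have hswap : (T.offDiag.filter fun p => ¬ p.1 < p.2).card =
      (T.offDiag.filter fun p => p.1 < p.2).card := by
    refine Finset.card_bij' (fun p _ => p.swap) (fun p _ => p.swap) ?_ ?_ ?_ ?_
    · rintro ⟨a, b⟩ h
      simp only [Finset.mem_filter, Finset.mem_offDiag, not_lt, Prod.fst_swap,
        Prod.snd_swap] at h ⊢
      exact ⟨⟨h.1.2.1, h.1.1, h.1.2.2.symm⟩, lt_of_le_of_ne h.2 h.1.2.2.symm⟩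
    · rintro ⟨a, b⟩ h
      simp only [Finset.mem_filter, Finset.mem_offDiag, not_lt, Prod.fst_swap,
        Prod.snd_swap] at h ⊢
      exact ⟨⟨h.1.2.1, h.1.1, h.1.2.2.symm⟩, h.2.le⟩
    · simp
    · simp
  have hadd := Finset.card_filter_add_card_filter_not (s := T.offDiag) (fun p => p.1 < p.2)
  rw [hswap, Finset.offDiag_card] at hadd
  rw [Nat.choose_two_right, Nat.mul_sub_one]
  omega

theorem card_pairIdx_within (n : ℕ) (T : Finset (Fin n)) :
    Fintype.card {p : PairIdx n // p.1.1 ∈ T ∧ p.1.2 ∈ T} = T.card.choose 2 := by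
  rw [← card_filter_lt_offDiag T, ← Fintype.card_coe]
  refine Fintype.card_congr
    ⟨fun p => ⟨p.1.1, ?_⟩, fun q => ⟨⟨q.1, ?_⟩, ?_⟩, fun _ => rfl, fun _ => rfl⟩
  · simp only [Finset.mem_filter, Finset.mem_offDiag]
    exact ⟨⟨p.2.1, p.2.2, p.1.2.ne⟩, p.1.2⟩
  · exact (Finset.mem_filter.1 q.2).2
  · have h := q.2
    simp only [Finset.mem_filter, Finset.mem_offDiag] at h
    exact ⟨h.1.1, h.1.2.1⟩

theorem card_pairIdx (n : ℕ) : Fintype.card (PairIdx n) = n.choose 2 := by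
  have h := card_pairIdx_within n Finset.univ
  rw [Finset.card_univ, Fintype.card_fin] at h
  rw [← h]
  exact (Fintype.card_congr (Equiv.subtypeUnivEquiv fun p => by simp)).symm

/-- All rows of `B` are linear combinations of the rows indexed outside `T`. -/
def RowsSpannedOff {ι K : Type*} [Fintype ι] [Semiring K] (T : Finset ι) (B : ι → ι → K) : Prop :=
  ∀ i, ∃ c : ι → K, (∀ r ∈ T, c r = 0) ∧ ∀ j, B i j = ∑ r, c r * B r j

/-- A symmetric matrix whose rows are spanned by those outside `T` is determined by its entries
outside `T × T`. -/
theorem RowsSpannedOff.eq_of_agree {ι K : Type*} [Fintype ι] [CommSemiring K] {T : Finset ι}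
    {B B' : ι → ι → K} (hB : RowsSpannedOff T B) (hB' : RowsSpannedOff T B')
    (hs : ∀ i j, B i j = B j i) (hs' : ∀ i j, B' i j = B' j i)
    (h : ∀ i, i ∉ T → ∀ j, B i j = B' i j) : B = B' := by
  have agree : ∀ c : ι → K, (∀ r ∈ T, c r = 0) → ∀ j, ∑ r, c r * B r j = ∑ r, c r * B' r j := by
    intro c hc j
    refine Finset.sum_congr rfl fun r _ => ?_
    by_cases hr : r ∈ T
    · rw [hc r hr, zero_mul, zero_mul]
    · rw [h r hr]
  funext i j
  obtain ⟨c, hc, hci⟩ := hB i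
  obtain ⟨c', hc', hcj⟩ := hB' j
  calc B i j = ∑ r, c r * B' r j := by rw [hci, agree c hc]
    _ = ∑ r, ∑ q, c' q * (c r * B' r q) := by
        refine Finset.sum_congr rfl fun r _ => ?_
        rw [hs', hcj, Finset.mul_sum]
        refine Finset.sum_congr rfl fun q _ => ?_
        rw [hs' q r]; ring
    _ = ∑ q, c' q * B i q := by
        rw [Finset.sum_comm]
        refine Finset.sum_congr rfl fun q _ => ?_
        rw [← Finset.mul_sum, hci, agree c hc]
    _ = ∑ q, c' q * B q i := Finset.sum_congr rfl fun q _ => by rw [hs]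
    _ = B' i j := by rw [agree c' hc', ← hcj, hs']

/-- Among `n` vectors of a `t`-dimensional space, one can discard any prescribed number
`s ≤ n - t` of them without changing the span. -/
theorem exists_card_eq_forall_mem_span_compl {ι K V : Type*} [Fintype ι] [DecidableEq ι] [Field K]
    [AddCommGroup V] [Module K V] [Module.Finite K V] (v : ι → V) {s : ℕ}
    (hs : s + Module.finrank K V ≤ Fintype.card ι) :
    ∃ T : Finset ι, T.card = s ∧
      ∀ i, v i ∈ Submodule.span K (v '' ((Tᶜ : Finset ι) : Set ι)) := by
  obtain ⟨κ, a, ha, hspan, hli⟩ := exists_linearIndependent' K v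
  have : Fintype κ := Fintype.ofInjective a ha
  set R : Finset ι := Finset.univ.image a with hR
  have hRcard : R.card ≤ Module.finrank K V :=
    Finset.card_image_le.trans (by simpa using hli.fintype_card_le_finrank)
  obtain ⟨T, hT, hTcard⟩ := Finset.exists_subset_card_eq (s := Rᶜ) (n := s)
    (by rw [Finset.card_compl]; omega)
  refine ⟨T, hTcard, fun i => ?_⟩
  have hi : v i ∈ Submodule.span K (Set.range (v ∘ a)) := by
    rw [hspan]; exact Submodule.subset_span ⟨i, rfl⟩
  refine Submodule.span_mono ?_ hi
  rintro _ ⟨k, rfl⟩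
  refine ⟨a k, ?_, rfl⟩
  simp only [Finset.coe_compl, Set.mem_compl_iff, Finset.mem_coe]
  intro hk
  have := hT hk
  simp [hR] at this

theorem exists_rowsSpannedOff_gram {ι K : Type*} [Fintype ι] [Field K] {s t : ℕ}
    (v : ι → Fin t → K) (hs : s + t ≤ Fintype.card ι) :
    ∃ T : Finset ι, T.card = s ∧ RowsSpannedOff T (fun i j => ∑ k, v i k * v j k) := by
  classical
  obtain ⟨T, hT, hspan⟩ := exists_card_eq_forall_mem_span_compl (K := K) v (s := s)
    (by simpa using hs)
  refine ⟨T, hT, fun i => ?_⟩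
  obtain ⟨c, hc⟩ := (Submodule.mem_span_image_finset_iff_exists_fun' K).1 (hspan i)
  refine ⟨fun r => if r ∈ T then 0 else c r, fun r hr => if_pos hr, fun j => ?_⟩
  have hv : v i = ∑ r, (if r ∈ T then 0 else c r) • v r := by
    rw [← hc, ← Finset.sum_subset (Finset.subset_univ Tᶜ)]
    · exact Finset.sum_congr rfl fun r hr => by rw [if_neg (Finset.mem_compl.1 hr)]
    · exact fun r _ hr => by rw [if_pos (by simpa using hr), zero_smul]
  simp only [Finset.mul_sum]
  rw [Finset.sum_comm]
  refine Finset.sum_congr rfl fun k _ => ?_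
  rw [hv, Finset.sum_apply, Finset.sum_mul]
  refine Finset.sum_congr rfl fun r _ => ?_
  rw [Pi.smul_apply, smul_eq_mul, mul_assoc]

/-- Vectors that are the off-diagonal part of a symmetric matrix whose rows are spanned by those
outside `T`. -/
def spannedOffSet (n : ℕ) (T : Finset (Fin n)) : Set (PairIdx n → ZMod 2) :=
  {z | ∃ B : Fin n → Fin n → ZMod 2, (∀ i j, B i j = B j i) ∧ RowsSpannedOff T B ∧
    ∀ p : PairIdx n, z p = B p.1.1 p.1.2}

theorem ncard_spannedOffSet_le (n : ℕ) (T : Finset (Fin n)) :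
    (spannedOffSet n T).ncard * 2 ^ T.card.choose 2 ≤ 2 ^ n * 2 ^ n.choose 2 := by
  classical
  choose! B hsymm hspan hz using fun z (hz : z ∈ spannedOffSet n T) => hz
  let Φ : spannedOffSet n T →
      (Fin n → ZMod 2) × ({p : PairIdx n // ¬ (p.1.1 ∈ T ∧ p.1.2 ∈ T)} → ZMod 2) :=
    fun z => (fun i => B z i i, fun p => z.1 p.1)
  have hΦ : Function.Injective Φ := by
    rintro ⟨z, hzm⟩ ⟨w, hwm⟩ h
    have hdiag : ∀ i, B z i i = B w i i := fun i => congrFun (congrArg Prod.fst h) i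
    have hoff : ∀ p : PairIdx n, ¬ (p.1.1 ∈ T ∧ p.1.2 ∈ T) → z p = w p :=
      fun p hp => congrFun (congrArg Prod.snd h) ⟨p, hp⟩
    have hB : B z = B w := by
      refine (hspan z hzm).eq_of_agree (hspan w hwm) (hsymm z hzm) (hsymm w hwm) fun i hi j => ?_
      rcases lt_trichotomy i j with hij | rfl | hij
      · exact (hz z hzm ⟨(i, j), hij⟩).symm.trans
          ((hoff ⟨(i, j), hij⟩ fun h => hi h.1).trans (hz w hwm ⟨(i, j), hij⟩))
      · exact hdiag i
      · rw [hsymm z hzm, hsymm w hwm]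
        exact (hz z hzm ⟨(j, i), hij⟩).symm.trans
          ((hoff ⟨(j, i), hij⟩ fun h => hi h.2).trans (hz w hwm ⟨(j, i), hij⟩))
    refine Subtype.ext (funext fun p => (hz z hzm p).trans ?_)
    rw [hB]
    exact (hz w hwm p).symm
  have hcard := Nat.card_le_card_of_injective Φ hΦ
  rw [Nat.card_coe_set_eq, Nat.card_eq_fintype_card, Fintype.card_prod, Fintype.card_fun,
    Fintype.card_fun, Fintype.card_fin, ZMod.card] at hcard
  have hsum := Fintype.card_subtype_compl (fun p : PairIdx n => p.1.1 ∈ T ∧ p.1.2 ∈ T)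
  have hle := Fintype.card_subtype_le (fun p : PairIdx n => p.1.1 ∈ T ∧ p.1.2 ∈ T)
  rw [card_pairIdx_within, card_pairIdx] at hsum hle
  rw [hsum] at hcard
  calc _ ≤ 2 ^ n * 2 ^ (n.choose 2 - T.card.choose 2) * 2 ^ T.card.choose 2 :=
        Nat.mul_le_mul_right _ hcard
    _ = _ := by rw [mul_assoc, ← pow_add, Nat.sub_add_cancel hle]

/-- The set of states the inversion walk can occupy at time `t`. -/
def reachableSet (n t : ℕ) : Set (PairIdx n → ZMod 2) :=
  Set.range fun Xs : Fin t → Finset (Fin n) => ∑ i, cliqueVec n (Xs i)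

theorem reachableSet_subset (n s t : ℕ) (h : s + t ≤ n) :
    reachableSet n t ⊆ ⋃ T ∈ Finset.powersetCard s Finset.univ, spannedOffSet n T := by
  rintro _ ⟨Xs, rfl⟩
  obtain ⟨T, hT, hspan⟩ := exists_rowsSpannedOff_gram (s := s)
    (fun (i : Fin n) (k : Fin t) => if i ∈ Xs k then (1 : ZMod 2) else 0) (by simpa using h)
  simp only [Set.mem_iUnion]
  refine ⟨T, by simp [hT], _, ?_, hspan, fun p => ?_⟩
  · exact fun i j => Finset.sum_congr rfl fun k _ => mul_comm _ _
  · rw [Finset.sum_apply]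
    refine Finset.sum_congr rfl fun k _ => ?_
    simp only [cliqueVec]
    split_ifs <;> simp_all

theorem ncard_reachableSet_le (n s t : ℕ) (h : s + t ≤ n) :
    (reachableSet n t).ncard * 2 ^ s.choose 2 ≤ 2 ^ n * n ^ s * 2 ^ n.choose 2 := by
  calc _ ≤ (∑ T ∈ Finset.powersetCard s (Finset.univ : Finset (Fin n)),
          (spannedOffSet n T).ncard) * 2 ^ s.choose 2 :=
        Nat.mul_le_mul_right _ ((Set.ncard_le_ncard (reachableSet_subset n s t h)).trans
          (Finset.set_ncard_biUnion_le _ _))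
    _ ≤ ∑ T ∈ Finset.powersetCard s (Finset.univ : Finset (Fin n)),
          2 ^ n * 2 ^ n.choose 2 := by
        rw [Finset.sum_mul]
        refine Finset.sum_le_sum fun T hT => ?_
        rw [← (Finset.mem_powersetCard.1 hT).2]
        exact ncard_spannedOffSet_le n T
    _ = n.choose s * (2 ^ n * 2 ^ n.choose 2) := by simp
    _ ≤ n ^ s * (2 ^ n * 2 ^ n.choose 2) := Nat.mul_le_mul_right _ (Nat.choose_le_pow n s)
    _ = _ := by ring

theorem sum_invMu (n t : ℕ) : ∑ z, invMu n t z = 1 := by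
  classical
  have h := Finset.card_eq_sum_card_fiberwise (s := Finset.univ) (t := Finset.univ)
    (f := fun Xs : Fin t → Finset (Fin n) => ∑ i, cliqueVec n (Xs i)) (by simp)
  simp only [Finset.card_univ, Fintype.card_fun, Fintype.card_finset, Fintype.card_fin,
    ← pow_mul] at h
  simp only [invMu]
  rw [← Finset.sum_div, ← Nat.cast_sum, ← h]
  simp

theorem one_sub_ncard_reachableSet_le_invDist (n t : ℕ) :
    1 - (reachableSet n t).ncard * ((2 : ℝ) ^ n.choose 2)⁻¹ ≤ invDist n t := by
  classical
  set u : ℝ := ((2 : ℝ) ^ n.choose 2)⁻¹ with hu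
  have hu0 : 0 ≤ u := by positivity
  have hterm : ∀ z, invMu n t z + u - 2 * (if z ∈ reachableSet n t then u else 0) ≤
      |invMu n t z - u| := by
    intro z
    split_ifs with hz
    · linarith [le_abs_self (invMu n t z - u)]
    · have h0 : invMu n t z = 0 := by
        have : (Finset.univ.filter fun Xs : Fin t → Finset (Fin n) =>
            ∑ i, cliqueVec n (Xs i) = z) = ∅ :=
          Finset.filter_eq_empty_iff.2 fun Xs _ h => hz ⟨Xs, h⟩
        simp [invMu, this]
      rw [h0, zero_sub, abs_neg, abs_of_nonneg hu0]
      linarith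
  have hsum := Finset.sum_le_sum fun z (_ : z ∈ Finset.univ) => hterm z
  rw [Finset.sum_sub_distrib, Finset.sum_add_distrib, sum_invMu, ← Finset.mul_sum,
    ← Finset.sum_filter, Finset.sum_const, Finset.sum_const, Finset.card_univ, Fintype.card_fun,
    ZMod.card, card_pairIdx, nsmul_eq_mul, nsmul_eq_mul] at hsum
  have hone : ((2 ^ n.choose 2 : ℕ) : ℝ) * u = 1 := by
    rw [hu]; push_cast; exact mul_inv_cancel₀ (by positivity)
  have hncard : (reachableSet n t).ncard =
      (Finset.univ.filter fun z => z ∈ reachableSet n t).card := by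
    rw [← Set.ncard_coe_finset]; simp
  rw [hone, ← hncard] at hsum
  rw [invDist, ← hu]
  linarith

/-- For every `n ≥ 1` and every `0 ≤ s ≤ n`, the inversion walk satisfies
`d_n(n - s) ≥ 1 - 2^n · n^s · 2^{-C(s,2)}`. -/
theorem inversion_walk_lower_tail (n : ℕ) (hn : 1 ≤ n) (s : ℕ) (hs : s ≤ n) :
    invDist n (n - s) ≥
      1 - (2 : ℝ) ^ n * (n : ℝ) ^ s * ((2 : ℝ) ^ s.choose 2)⁻¹ := by
  refine le_trans ?_ (one_sub_ncard_reachableSet_le_invDist n (n - s))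
  have h : ((reachableSet n (n - s)).ncard : ℝ) * 2 ^ s.choose 2 ≤
      2 ^ n * n ^ s * 2 ^ n.choose 2 := by
    exact_mod_cast ncard_reachableSet_le n s (n - s) (by omega)
  rw [← div_eq_mul_inv, ← div_eq_mul_inv]
  refine sub_le_sub_left ?_ _
  rwa [div_le_div_iff₀ (by positivity) (by positivity)]
end

section
/- For every n ≥ 1, Σ_{A ∈ F_2^{C(n,2)}, A ≠ 0} 2^{−r(A)(n−1)} ≤ 2.252, where the sum is over all nonzero A ∈ F_2^{C(n,2)} and is taken in the real numbers. -/
open scoped BigOperators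

/-- The symmetric `n × n` matrix `M_A` over `F_2` with zero diagonal whose `(i,j)`-entry
for `i ≠ j` is the coordinate of `A` at `{i,j}`; `r(A) := rank_{F_2}(M_A)`. -/
def matA (n : ℕ) (A : PairIdx n → ZMod 2) : Matrix (Fin n) (Fin n) (ZMod 2) :=
  Matrix.of fun i j =>
    if h : i < j then A ⟨(i, j), h⟩ else if h : j < i then A ⟨(j, i), h⟩ else 0

/-- A first column outside the span of the others increases the rank. -/
theorem rank_delete_col_lt {m k : ℕ} (B : Matrix (Fin m) (Fin (k + 1)) (ZMod 2))
    (h : (fun i => B i 0) ∉ LinearMap.range (B.submatrix id Fin.succ).mulVecLin) :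
    (B.submatrix id Fin.succ).rank < B.rank := by
  apply Submodule.finrank_lt_finrank_of_lt
  refine lt_of_le_of_ne ?_ fun he => h ?_
  · rw [Matrix.range_mulVecLin, Matrix.range_mulVecLin]
    apply Submodule.span_mono
    rintro _ ⟨j, rfl⟩
    exact ⟨j.succ, rfl⟩
  · rw [he, Matrix.range_mulVecLin]
    exact Submodule.subset_span ⟨0, rfl⟩

/-- Restriction of the coordinates to pairs avoiding the first vertex. -/
def restrictTail (n : ℕ) (A : PairIdx (n + 1) → ZMod 2) : PairIdx n → ZMod 2 :=
  fun p => A ⟨(p.1.1.succ, p.1.2.succ), Fin.succ_lt_succ_iff.2 p.2⟩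

/-- The coordinates at pairs containing the first vertex. -/
def firstRow (n : ℕ) (A : PairIdx (n + 1) → ZMod 2) : Fin n → ZMod 2 :=
  fun j => A ⟨(0, j.succ), Fin.succ_pos j⟩

theorem restrictTail_firstRow_injective (n : ℕ) :
    Function.Injective fun A : PairIdx (n + 1) → ZMod 2 => (restrictTail n A, firstRow n A) := by
  intro A B h
  have h1 : restrictTail n A = restrictTail n B := congrArg Prod.fst h
  have h2 : firstRow n A = firstRow n B := congrArg Prod.snd h
  funext ⟨⟨i, j⟩, hij⟩
  have hij' : i < j := hij
  obtain ⟨j, rfl⟩ := Fin.exists_succ_eq.2 (Fin.ne_zero_of_lt hij')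
  cases i using Fin.cases with
  | zero => exact congrFun h2 j
  | succ i => exact congrFun h1 ⟨(i, j), Fin.succ_lt_succ_iff.1 hij'⟩

theorem matA_transpose (n : ℕ) (A : PairIdx n → ZMod 2) : (matA n A).transpose = matA n A := by
  ext i j
  rcases lt_trichotomy i j with h | h | h
  · simp [matA, h, h.not_gt]
  · simp [matA, h]
  · simp [matA, h, h.not_gt]

theorem matA_submatrix_succ (n : ℕ) (A : PairIdx (n + 1) → ZMod 2) :
    (matA (n + 1) A).submatrix Fin.succ Fin.succ = matA n (restrictTail n A) := by
  ext i j
  simp [matA, restrictTail]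

theorem matA_succ_zero (n : ℕ) (A : PairIdx (n + 1) → ZMod 2) (i : Fin n) :
    matA (n + 1) A i.succ 0 = firstRow n A i := by
  simp [matA, firstRow]

theorem rank_restrictTail_le (n : ℕ) (A : PairIdx (n + 1) → ZMod 2) :
    (matA n (restrictTail n A)).rank ≤ (matA (n + 1) A).rank := by
  rw [← matA_submatrix_succ]
  exact Matrix.rank_submatrix_le _ _ _

theorem rank_restrictTail_add_two_le (n : ℕ) (A : PairIdx (n + 1) → ZMod 2)
    (h : firstRow n A ∉ LinearMap.range (matA n (restrictTail n A)).mulVecLin) :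
    (matA n (restrictTail n A)).rank + 2 ≤ (matA (n + 1) A).rank := by
  have h1 := rank_delete_col_lt (matA (n + 1) A) (by
    rintro ⟨y, hy⟩
    refine h ⟨y, ?_⟩
    ext i
    rw [← matA_succ_zero, ← matA_submatrix_succ]
    exact congrFun hy i.succ)
  have h2 := rank_delete_col_lt ((matA (n + 1) A).submatrix Fin.succ id) (by
    rintro ⟨y, hy⟩
    refine h ⟨y, ?_⟩
    ext i
    rw [← matA_succ_zero, ← matA_submatrix_succ]
    exact congrFun hy i)
  have h3 : ((matA (n + 1) A).submatrix id Fin.succ).rank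
      = ((matA (n + 1) A).submatrix Fin.succ id).rank := by
    rw [← Matrix.rank_transpose, Matrix.transpose_submatrix, matA_transpose]
  have h4 : ((matA (n + 1) A).submatrix Fin.succ id).submatrix id Fin.succ
      = matA n (restrictTail n A) := matA_submatrix_succ n A
  rw [h4] at h2
  omega

/-- The rank generating function of the alternating `n × n` matrices over `F_2`. -/
noncomputable def rankGen (n : ℕ) (t : ℝ) : ℝ :=
  ∑ A : PairIdx n → ZMod 2, t ^ (matA n A).rank

open Classical in
theorem rankGen_succ_le (n : ℕ) (t : ℝ) (h0 : 0 ≤ t) (h1 : t ≤ 1) :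
    rankGen (n + 1) t ≤ rankGen n (2 * t) + 2 ^ n * t ^ 2 * rankGen n t := by
  let f : (PairIdx n → ZMod 2) × (Fin n → ZMod 2) → ℝ := fun p =>
    if p.2 ∈ LinearMap.range (matA n p.1).mulVecLin then t ^ (matA n p.1).rank
    else t ^ ((matA n p.1).rank + 2)
  have hf : ∀ p, 0 ≤ f p := fun p => by
    simp only [f]; split_ifs <;> positivity
  calc rankGen (n + 1) t
      ≤ ∑ A : PairIdx (n + 1) → ZMod 2, f (restrictTail n A, firstRow n A) := by
        refine Finset.sum_le_sum fun A _ => ?_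
        simp only [f]
        split_ifs with h
        · exact pow_le_pow_of_le_one h0 h1 (rank_restrictTail_le n A)
        · exact pow_le_pow_of_le_one h0 h1 (rank_restrictTail_add_two_le n A h)
    _ = ∑ p ∈ Finset.univ.map ⟨_, restrictTail_firstRow_injective n⟩, f p := by
        rw [Finset.sum_map]; rfl
    _ ≤ ∑ p, f p :=
        Finset.sum_le_sum_of_subset_of_nonneg (Finset.subset_univ _) fun p _ _ => hf p
    _ = ∑ A : PairIdx n → ZMod 2, ∑ v : Fin n → ZMod 2, f (A, v) := Fintype.sum_prod_type _
    _ ≤ ∑ A : PairIdx n → ZMod 2,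
          ((2 * t) ^ (matA n A).rank + 2 ^ n * t ^ 2 * t ^ (matA n A).rank) := by
        refine Finset.sum_le_sum fun A _ => ?_
        have hcard : Fintype.card (LinearMap.range (matA n A).mulVecLin)
            = 2 ^ (matA n A).rank := by
          rw [Module.card_eq_pow_finrank (K := ZMod 2), ZMod.card]; rfl
        have hle : ∀ v : Fin n → ZMod 2, f (A, v) ≤
            (if v ∈ LinearMap.range (matA n A).mulVecLin then t ^ (matA n A).rank else 0)
              + t ^ ((matA n A).rank + 2) := fun v => by
          simp only [f]; split_ifs
          · exact le_add_of_nonneg_right (by positivity)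
          · exact (zero_add _).ge
        refine (Finset.sum_le_sum fun v _ => hle v).trans (le_of_eq ?_)
        rw [Finset.sum_add_distrib, ← Finset.sum_filter, Finset.sum_const, Finset.sum_const,
          ← Fintype.card_subtype, hcard]
        simp
        ring
    _ = rankGen n (2 * t) + 2 ^ n * t ^ 2 * rankGen n t := by
        rw [Finset.sum_add_distrib, ← Finset.mul_sum]; rfl

theorem rankGen_eq_one_of_isEmpty (n : ℕ) [IsEmpty (PairIdx n)] (t : ℝ) : rankGen n t = 1 := by
  have h : ∀ A : PairIdx n → ZMod 2, matA n A = 0 := fun A => by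
    ext i j
    rcases lt_trichotomy i j with h | h | h
    · exact (IsEmpty.false (α := PairIdx n) ⟨(i, j), h⟩).elim
    · simp [matA, h]
    · exact (IsEmpty.false (α := PairIdx n) ⟨(j, i), h⟩).elim
  simp [rankGen, h]

theorem rankGen_self_le (n : ℕ) : rankGen n ((2 : ℝ)⁻¹ ^ n) ≤ 2 - (2 : ℝ)⁻¹ ^ n := by
  induction n with
  | zero =>
    have : IsEmpty (PairIdx 0) := ⟨fun p => p.1.1.elim0⟩
    rw [rankGen_eq_one_of_isEmpty]; norm_num
  | succ n ih =>
    have h := rankGen_succ_le n ((2 : ℝ)⁻¹ ^ (n + 1)) (by positivity)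
      (pow_le_one₀ (by norm_num) (by norm_num))
    have hu : (2 : ℝ) ^ n * (2 : ℝ)⁻¹ ^ n = 1 := by rw [← mul_pow]; norm_num
    have hp : (0 : ℝ) < (2 : ℝ)⁻¹ ^ n := by positivity
    rw [show 2 * (2 : ℝ)⁻¹ ^ (n + 1) = (2 : ℝ)⁻¹ ^ n by ring] at h
    have hc : (2 : ℝ) ^ n * ((2 : ℝ)⁻¹ ^ (n + 1)) ^ 2 = (2 : ℝ)⁻¹ ^ n / 4 := by
      linear_combination ((2 : ℝ)⁻¹ ^ n / 4) * hu
    have hm : rankGen n ((2 : ℝ)⁻¹ ^ (n + 1)) ≤ rankGen n ((2 : ℝ)⁻¹ ^ n) :=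
      Finset.sum_le_sum fun A _ => pow_le_pow_left₀ (by positivity)
        (pow_le_pow_of_le_one (by norm_num) (by norm_num) n.le_succ) _
    rw [hc] at h
    rw [pow_succ (2 : ℝ)⁻¹ n] at h hm ⊢
    nlinarith [mul_le_mul_of_nonneg_left (hm.trans ih) hp.le]

theorem rankGen_succ_pow_le (n : ℕ) :
    rankGen (n + 1) ((2 : ℝ)⁻¹ ^ n) ≤ 3 - 2 * (2 : ℝ)⁻¹ ^ n := by
  induction n with
  | zero =>
    have : IsEmpty (PairIdx 1) := ⟨fun p => p.2.ne (Subsingleton.elim _ _)⟩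
    rw [rankGen_eq_one_of_isEmpty]; norm_num
  | succ n ih =>
    have h := rankGen_succ_le (n + 1) ((2 : ℝ)⁻¹ ^ (n + 1)) (by positivity)
      (pow_le_one₀ (by norm_num) (by norm_num))
    have hs := rankGen_self_le (n + 1)
    have hu : (2 : ℝ) ^ n * (2 : ℝ)⁻¹ ^ n = 1 := by rw [← mul_pow]; norm_num
    have hp : (0 : ℝ) < (2 : ℝ)⁻¹ ^ n := by positivity
    rw [show 2 * (2 : ℝ)⁻¹ ^ (n + 1) = (2 : ℝ)⁻¹ ^ n by ring] at h
    have hc : (2 : ℝ) ^ (n + 1) * ((2 : ℝ)⁻¹ ^ (n + 1)) ^ 2 = (2 : ℝ)⁻¹ ^ n / 2 := by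
      linear_combination ((2 : ℝ)⁻¹ ^ n / 2) * hu
    rw [hc] at h
    rw [pow_succ (2 : ℝ)⁻¹ n] at h hs ⊢
    nlinarith [mul_le_mul_of_nonneg_left hs hp.le]

/-- For every `n ≥ 1`, `Σ_{A ≠ 0} 2^{-r(A)(n-1)} ≤ 2.252`. -/
theorem rank_sum_at_n_sub_one (n : ℕ) (hn : 1 ≤ n) :
    ∑ A ∈ Finset.univ.filter (fun A : PairIdx n → ZMod 2 => A ≠ 0),
        ((2 : ℝ)⁻¹) ^ ((matA n A).rank * (n - 1)) ≤ 2.252 := by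
  obtain ⟨n, rfl⟩ := Nat.exists_eq_add_of_le' hn
  have h := rankGen_succ_pow_le n
  have h0 : matA (n + 1) 0 = 0 := by
    ext i j
    simp only [matA, Matrix.of_apply, Matrix.zero_apply]
    split_ifs <;> rfl
  rw [rankGen, ← Finset.add_sum_erase _ _ (Finset.mem_univ 0), h0, Matrix.rank_zero, pow_zero,
    ← Finset.filter_ne'] at h
  have hp : (0 : ℝ) < (2 : ℝ)⁻¹ ^ n := by positivity
  simp only [← pow_mul, mul_comm n] at h
  rw [Nat.add_sub_cancel]
  refine le_trans (b := 2) ?_ (by norm_num)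
  linarith
end

section
/- Let n ≥ 4 and 2 ≤ k ≤ n − 2 with k ≡ 0 (mod 4). Then H_k, the F_2-span of the clique vectors {v_X : X ⊆ [n], |X| = k}, equals ker(e), the subspace of F_2^{C(n,2)} consisting of edge-sets of even size. -/
open scoped BigOperators

/-- `H_k`: the `F_2`-linear span of the clique vectors `{v_X : X ⊆ [n], |X| = k}`. -/
def Hk (n k : ℕ) : Submodule (ZMod 2) (PairIdx n → ZMod 2) :=
  Submodule.span (ZMod 2) {v | ∃ X : Finset (Fin n), X.card = k ∧ cliqueVec n X = v}

/-- The edge-count parity map `e : F_2^{C(n,2)} → F_2`, `e(F) = |F| mod 2`. -/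
def eMap (n : ℕ) : (PairIdx n → ZMod 2) →ₗ[ZMod 2] ZMod 2 :=
  ∑ p : PairIdx n, LinearMap.proj p

/-- The degree-parity map `∂ : F_2^{C(n,2)} → F_2^n`, `∂(F)_v = deg_F(v) mod 2`. -/
def dMap (n : ℕ) : (PairIdx n → ZMod 2) →ₗ[ZMod 2] (Fin n → ZMod 2) :=
  LinearMap.pi fun v =>
    ∑ p ∈ Finset.univ.filter (fun p : PairIdx n => p.1.1 = v ∨ p.1.2 = v),
      LinearMap.proj p

lemma cliqueVec_empty (n : ℕ) : cliqueVec n ∅ = 0 := by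
  funext p
  simp [cliqueVec]

lemma cliqueVec_insert {n : ℕ} {a : Fin n} {A : Finset (Fin n)} (ha : a ∉ A) :
    cliqueVec n (insert a A) = cliqueVec n A + ∑ x ∈ A, cliqueVec n {a, x} := by
  funext p
  have hne : p.1.1 ≠ p.1.2 := ne_of_lt p.2
  rw [Pi.add_apply, Finset.sum_apply]
  simp only [cliqueVec, Finset.mem_insert, Finset.mem_singleton]
  generalize p.1.1 = i, p.1.2 = j at hne
  by_cases hi : i = a
  · subst hi
    simp [ha, hne.symm]
  · by_cases hj : j = a
    · subst hj
      simp [ha, hne]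
    · have h : ∀ x, ¬ (i = x ∧ j = x) := fun x h => hne (h.1.trans h.2.symm)
      simp [hi, hj, h]

lemma cliqueVec_pair_eq_single {n : ℕ} (p : PairIdx n) :
    cliqueVec n {p.1.1, p.1.2} = Pi.single p 1 := by
  funext q
  have hp : p.1.1 < p.1.2 := p.2
  have hq : q.1.1 < q.1.2 := q.2
  have hpq : q = p ↔ q.1.1 = p.1.1 ∧ q.1.2 = p.1.2 := Subtype.ext_iff.trans Prod.ext_iff
  simp only [cliqueVec, Finset.mem_insert, Finset.mem_singleton, Pi.single_apply, hpq]
  congr 1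
  grind

lemma eMap_single {n : ℕ} (p : PairIdx n) : eMap n (Pi.single p 1) = 1 := by
  simp [eMap, LinearMap.sum_apply]

lemma eMap_cliqueVec_pair {n : ℕ} {a b : Fin n} (hab : a ≠ b) :
    eMap n (cliqueVec n {a, b}) = 1 := by
  rcases lt_or_gt_of_ne hab with h | h
  · exact (congrArg _ (cliqueVec_pair_eq_single ⟨(a, b), h⟩)).trans (eMap_single _)
  · rw [Finset.pair_comm]
    exact (congrArg _ (cliqueVec_pair_eq_single ⟨(b, a), h⟩)).trans (eMap_single _)

lemma eMap_cliqueVec {n : ℕ} (X : Finset (Fin n)) :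
    eMap n (cliqueVec n X) = (X.card.choose 2 : ℕ) := by
  induction X using Finset.induction_on with
  | empty => simp [cliqueVec_empty]
  | insert a A ha ih =>
    have h : ∀ x ∈ A, eMap n (cliqueVec n {a, x}) = 1 := fun x hx =>
      eMap_cliqueVec_pair fun h => ha (h ▸ hx)
    rw [cliqueVec_insert ha, map_add, map_sum, Finset.sum_congr rfl h, ih,
      Finset.card_insert_of_notMem ha, Nat.choose_succ_succ' A.card 1]
    simp [add_comm]

lemma cliqueVec_mem_Hk {n k : ℕ} {X : Finset (Fin n)} (hX : X.card = k) :
    cliqueVec n X ∈ Hk n k :=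
  Submodule.subset_span ⟨X, hX, rfl⟩

lemma sum_star_sub_mem_Hk {n k : ℕ} {a b : Fin n} {A : Finset (Fin n)} (ha : a ∉ A)
    (hb : b ∉ A) (hA : A.card + 1 = k) :
    ∑ x ∈ A, (cliqueVec n {a, x} - cliqueVec n {b, x}) ∈ Hk n k := by
  have h := sub_mem
    (cliqueVec_mem_Hk ((Finset.card_insert_of_notMem ha).trans hA))
    (cliqueVec_mem_Hk ((Finset.card_insert_of_notMem hb).trans hA))
  rwa [cliqueVec_insert ha, cliqueVec_insert hb, add_sub_add_left_eq_sub,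
    ← Finset.sum_sub_distrib] at h

lemma exists_card_eq_disjoint {n m : ℕ} (S : Finset (Fin n)) (h : m + S.card ≤ n) :
    ∃ B : Finset (Fin n), B.card = m ∧ ∀ x ∈ S, x ∉ B := by
  have hc : m ≤ Sᶜ.card := by
    rw [Finset.card_compl, Fintype.card_fin]
    omega
  obtain ⟨B, hB, hcard⟩ := Finset.exists_subset_card_eq hc
  exact ⟨B, hcard, fun x hx hxB => Finset.mem_compl.1 (hB hxB) hx⟩

/-- The 4-cycle `a c b d` lies in `H_k`. -/
lemma four_cycle_mem_Hk {n k : ℕ} (hk : 2 ≤ k) (hkn : k + 2 ≤ n) {a b c d : Fin n}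
    (hac : a ≠ c) (hbc : b ≠ c) (had : a ≠ d) (hbd : b ≠ d) :
    (cliqueVec n {a, c} - cliqueVec n {b, c}) - (cliqueVec n {a, d} - cliqueVec n {b, d})
      ∈ Hk n k := by
  have h4 : ({a, b, c, d} : Finset (Fin n)).card ≤ 4 := Finset.card_le_four
  obtain ⟨B, hB, hdisj⟩ := exists_card_eq_disjoint (m := k - 2) {a, b, c, d} (by omega)
  have ha : a ∉ B := hdisj a (by simp)
  have hb : b ∉ B := hdisj b (by simp)
  have hc : c ∉ B := hdisj c (by simp)
  have hd : d ∉ B := hdisj d (by simp)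
  have h := sub_mem
    (sum_star_sub_mem_Hk (k := k) (a := a) (b := b) (A := insert c B) (by simp [ha, hac])
      (by simp [hb, hbc]) (by rw [Finset.card_insert_of_notMem hc]; omega))
    (sum_star_sub_mem_Hk (k := k) (a := a) (b := b) (A := insert d B) (by simp [ha, had])
      (by simp [hb, hbd]) (by rw [Finset.card_insert_of_notMem hd]; omega))
  rwa [Finset.sum_insert hc, Finset.sum_insert hd, add_sub_add_right_eq_sub] at h

/-- For even `k`, the path `a x b` lies in `H_k`. -/
lemma path_mem_Hk {n k : ℕ} (hk : 2 ≤ k) (hkn : k + 2 ≤ n) (heven : Even k)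
    {a b x : Fin n} (hax : a ≠ x) (hbx : b ≠ x) :
    cliqueVec n {a, x} - cliqueVec n {b, x} ∈ Hk n k := by
  have h3 : ({a, b, x} : Finset (Fin n)).card ≤ 3 := Finset.card_le_three
  obtain ⟨B, hB, hdisj⟩ := exists_card_eq_disjoint (m := k - 2) {a, b, x} (by omega)
  have ha : a ∉ B := hdisj a (by simp)
  have hb : b ∉ B := hdisj b (by simp)
  have hx : x ∉ B := hdisj x (by simp)
  set g : Fin n → PairIdx n → ZMod 2 := fun y => cliqueVec n {a, y} - cliqueVec n {b, y}
  have hsum : ∑ y ∈ insert x B, g y ∈ Hk n k :=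
    sum_star_sub_mem_Hk (by simp [ha, hax]) (by simp [hb, hbx])
      (by rw [Finset.card_insert_of_notMem hx]; omega)
  have hcyc : ∑ y ∈ B, (g y - g x) ∈ Hk n k := Submodule.sum_mem _ fun y hy =>
    four_cycle_mem_Hk hk hkn (fun h => ha (h ▸ hy)) (fun h => hb (h ▸ hy)) hax hbx
  have hzero : B.card • g x = 0 := by
    have : ((B.card : ℕ) : ZMod 2) = 0 := by
      rw [ZMod.natCast_eq_zero_iff_even, hB]
      exact (Nat.even_sub hk).2 (by simp [heven])
    rw [← Nat.cast_smul_eq_nsmul (ZMod 2), this, zero_smul]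
  have h := sub_mem hsum hcyc
  rwa [Finset.sum_insert hx, Finset.sum_sub_distrib g, Finset.sum_const, hzero, sub_zero,
    add_sub_cancel_right] at h

lemma single_sub_single_mem_Hk {n k : ℕ} (hk : 2 ≤ k) (hkn : k + 2 ≤ n) (heven : Even k)
    (p q : PairIdx n) :
    (Pi.single p 1 - Pi.single q 1 : PairIdx n → ZMod 2) ∈ Hk n k := by
  rw [← cliqueVec_pair_eq_single, ← cliqueVec_pair_eq_single]
  obtain ⟨⟨a, b⟩, hab⟩ := p
  obtain ⟨⟨c, d⟩, hcd⟩ := q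
  have hab : a ≠ b := ne_of_lt hab
  have hcd : c ≠ d := ne_of_lt hcd
  simp only
  by_cases had : a = d
  · subst had
    rw [Finset.pair_comm a b]
    exact path_mem_Hk hk hkn heven hab.symm hcd
  · have h₁ := path_mem_Hk hk hkn heven hab.symm (Ne.symm had)
    have h₂ := path_mem_Hk hk hkn heven had hcd
    rw [Finset.pair_comm b a, Finset.pair_comm d a] at h₁
    simpa using add_mem h₁ h₂

/-- For `n ≥ 4`, `2 ≤ k ≤ n - 2` and `k ≡ 0 (mod 4)`, the span `H_k` of the `k`-clique
vectors equals `ker(e)`, the subspace of edge-sets of even size. -/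
theorem Hk_eq_ker_e (n k : ℕ) (hn : 4 ≤ n) (hk2 : 2 ≤ k) (hkn : k ≤ n - 2)
    (hmod : k % 4 = 0) : Hk n k = LinearMap.ker (eMap n) := by
  have heven : Even k := Nat.even_iff.2 (by omega)
  have hkn' : k + 2 ≤ n := by omega
  apply le_antisymm
  · refine Submodule.span_le.2 ?_
    rintro _ ⟨X, hX, rfl⟩
    obtain ⟨m, rfl⟩ := Nat.dvd_of_mod_eq_zero hmod
    have hchoose : (4 * m).choose 2 = 2 * (m * (4 * m - 1)) := by
      rw [Nat.choose_two_right, show 4 * m * (4 * m - 1) = 2 * (2 * (m * (4 * m - 1))) by ring]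
      exact Nat.mul_div_cancel_left _ two_pos
    rw [SetLike.mem_coe, LinearMap.mem_ker, eMap_cliqueVec, hX, hchoose,
      ZMod.natCast_eq_zero_iff]
    exact dvd_mul_right _ _
  · intro v hv
    have hsum : ∑ p, v p = 0 := by
      simpa [eMap, LinearMap.sum_apply] using hv
    let q : PairIdx n := ⟨(⟨0, by omega⟩, ⟨1, by omega⟩), by simp⟩
    have hv' : v = ∑ p, v p • (Pi.single p 1 - Pi.single q 1 : PairIdx n → ZMod 2) := by
      simp only [smul_sub]
      rw [Finset.sum_sub_distrib, ← Finset.sum_smul, hsum, zero_smul, sub_zero]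
      exact pi_eq_sum_univ' v
    rw [hv']
    exact Submodule.sum_mem _ fun p _ =>
      Submodule.smul_mem _ _ (single_sub_single_mem_Hk hk2 hkn' heven p q)
end
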